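/- Let L ≥ 4 be even, and let A, B, C be pairwise disjoint nonempty contiguous arcs of ZMod L whose union is ZMod L, with |A| ≥ 2. Then there is no nonzero vector ψ in the chain Hilbert space that is separable with respect to the partition {A, B, C} (i.e., ψ(b) = f(b|_A) g(b|_B) h(b|_C)) and is an eigenvector of U_CZX (i.e., U_CZX ψ = λ ψ for some λ ∈ ℂ). -/

import Mathlib

open Matrix

/-- The CZX operator on a periodic chain of `L` qubits:
`U_CZX |b⟩ = (−1)^{Σ_i b_i b_{i+1}} |¬b⟩`. -/
noncomputable def czxMatrix (L : ℕ) [NeZero L] :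
    Matrix (ZMod L → Bool) (ZMod L → Bool) ℂ :=
  Matrix.of fun b b' =>
    if b = (fun i => ! b' i) then
      ∏ i : ZMod L, (if b' i && b' (i + 1) then (-1 : ℂ) else 1)
    else 0

/-- A contiguous arc `{j, j+1, …, j+m−1}` in `ZMod L`. -/
def IsArc {L : ℕ} (A : Set (ZMod L)) : Prop :=
  ∃ (j : ZMod L) (m : ℕ), A = {x | ∃ k, k < m ∧ x = j + (k : ZMod L)}

/-- A vector of the chain Hilbert space separable with respect to the
tripartition `{A, B, C}`: `ψ(b) = f(b|_A) g(b|_B) h(b|_C)`. -/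
def SepVec3 {L : ℕ} (A B C : Set (ZMod L)) (ψ : (ZMod L → Bool) → ℂ) : Prop :=
  ∃ (f : (A → Bool) → ℂ) (g : (B → Bool) → ℂ) (h : (C → Bool) → ℂ),
    ∀ b, ψ b = f (fun x => b x.1) * g (fun x => b x.1) * h (fun x => b x.1)

/-- The diagonal sign `(−1)^{Σ_i b_i b_{i+1}}` of the CZX operator. -/
noncomputable def czxSign {L : ℕ} [NeZero L] (b : ZMod L → Bool) : ℂ :=
  ∏ i : ZMod L, (if b i && b (i + 1) then (-1 : ℂ) else 1)

lemma czxSign_mul_self {L : ℕ} [NeZero L] (b : ZMod L → Bool) : czxSign b * czxSign b = 1 := by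
  rw [czxSign, ← Finset.prod_mul_distrib]
  refine Finset.prod_eq_one fun i _ => ?_
  split_ifs <;> simp

lemma czxSign_ne_zero {L : ℕ} [NeZero L] (b : ZMod L → Bool) : czxSign b ≠ 0 :=
  left_ne_zero_of_mul_eq_one (czxSign_mul_self b)

lemma czxMatrix_mulVec_compl {L : ℕ} [NeZero L] (ψ : (ZMod L → Bool) → ℂ) (b : ZMod L → Bool) :
    (czxMatrix L).mulVec ψ (fun i => ! b i) = czxSign b * ψ b := by
  simp only [Matrix.mulVec, dotProduct, czxMatrix, Matrix.of_apply]
  rw [Finset.sum_eq_single b]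
  · simp [czxSign]
  · intro b' _ hb'
    rw [if_neg, zero_mul]
    intro h
    apply hb'
    funext i
    have := congrFun h i
    simpa using this.symm
  · simp

open Classical in
/-- Flip the bits of `b` at the sites in `S`. -/
noncomputable def flipOn {L : ℕ} (S : Set (ZMod L)) (b : ZMod L → Bool) : ZMod L → Bool :=
  fun i => if i ∈ S then ! b i else b i

open Classical in
/-- The sites `i` whose bond `(i, i+1)` joins `S` to `T`. -/
noncomputable def bonds {L : ℕ} [NeZero L] (S T : Set (ZMod L)) : Finset (ZMod L) :=
  Finset.univ.filter fun i => (i ∈ S ∧ i + 1 ∈ T) ∨ (i ∈ T ∧ i + 1 ∈ S)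

lemma bonds_comm {L : ℕ} [NeZero L] (S T : Set (ZMod L)) : bonds S T = bonds T S := by
  ext i
  simp [bonds, or_comm]

lemma bonds_union_right_card {L : ℕ} [NeZero L] {S T U : Set (ZMod L)}
    (hST : Disjoint S T) (hSU : Disjoint S U) (hTU : Disjoint T U) :
    (bonds S (T ∪ U)).card = (bonds S T).card + (bonds S U).card := by
  classical
  rw [Set.disjoint_left] at hST hSU hTU
  rw [← Finset.card_union_of_disjoint]
  · congr 1
    ext i
    simp only [bonds, Finset.mem_filter, Finset.mem_univ, true_and, Finset.mem_union,
      Set.mem_union]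
    tauto
  · rw [Finset.disjoint_left]
    intro i
    simp only [bonds, Finset.mem_filter, Finset.mem_univ, true_and]
    have h1 := @hST i
    have h2 := @hSU i
    have h3 := @hTU i
    have h4 := @hST (i + 1)
    have h5 := @hSU (i + 1)
    have h6 := @hTU (i + 1)
    tauto

/-- A nonempty proper arc has exactly two boundary bonds. -/
lemma IsArc.card_bonds_compl {L : ℕ} [NeZero L] {A : Set (ZMod L)} (hA : IsArc A)
    (hne : A.Nonempty) (hproper : A ≠ Set.univ) : (bonds A Aᶜ).card = 2 := by
  classical
  obtain ⟨j, m, rfl⟩ := hA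
  have hLpos : 0 < L := Nat.pos_of_ne_zero (NeZero.ne L)
  have hm : 0 < m := by
    obtain ⟨x, k, hk, -⟩ := hne
    omega
  have hmL : m < L := by
    by_contra hle
    apply hproper
    ext x
    simp only [Set.mem_ofPred_eq, Set.mem_univ, iff_true]
    refine ⟨(x - j).val, lt_of_lt_of_le (ZMod.val_lt _) (not_lt.1 hle), ?_⟩
    simp
  have hmem (e : ℕ) (he : e < L) :
      (j + (e : ZMod L)) ∈ {x : ZMod L | ∃ k, k < m ∧ x = j + (k : ZMod L)} ↔ e < m := by
    constructor
    · rintro ⟨k, hk, hx⟩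
      have h := congrArg ZMod.val (add_left_cancel hx)
      rw [ZMod.val_natCast_of_lt he, ZMod.val_natCast_of_lt (hk.trans hmL)] at h
      omega
    · exact fun h => ⟨e, h, rfl⟩
  have hinj {e e' : ℕ} (he : e < L) (he' : e' < L) :
      (j + (e : ZMod L)) = j + (e' : ZMod L) ↔ e = e' := by
    refine ⟨fun hx => ?_, fun h => by rw [h]⟩
    have h := congrArg ZMod.val (add_left_cancel hx)
    rwa [ZMod.val_natCast_of_lt he, ZMod.val_natCast_of_lt he'] at h
  have hset : bonds {x : ZMod L | ∃ k, k < m ∧ x = j + (k : ZMod L)}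
      {x : ZMod L | ∃ k, k < m ∧ x = j + (k : ZMod L)}ᶜ =
      {j + ((m - 1 : ℕ) : ZMod L), j + ((L - 1 : ℕ) : ZMod L)} := by
    ext i
    obtain ⟨e, he, rfl⟩ : ∃ e : ℕ, e < L ∧ i = j + (e : ZMod L) :=
      ⟨(i - j).val, ZMod.val_lt _, by simp⟩
    simp only [bonds, Finset.mem_filter, Finset.mem_univ, true_and, Set.mem_compl_iff,
      Finset.mem_insert, Finset.mem_singleton]
    rw [hinj he (by omega), hinj he (by omega), hmem e he]
    by_cases hlast : e + 1 = L
    · have hsucc : j + (e : ZMod L) + 1 = j + ((0 : ℕ) : ZMod L) := by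
        have : ((e + 1 : ℕ) : ZMod L) = 0 := by rw [hlast]; simp
        push_cast at this
        rw [add_assoc, this]
        simp
      rw [hsucc, hmem 0 hLpos]
      omega
    · have hsucc : j + (e : ZMod L) + 1 = j + ((e + 1 : ℕ) : ZMod L) := by
        push_cast
        ring
      rw [hsucc, hmem (e + 1) (by omega)]
      omega
  rw [hset, Finset.card_pair]
  rw [Ne, hinj (by omega) (by omega)]
  omega

/-- Three nonempty arcs partitioning the ring are pairwise joined by exactly one bond. -/
lemma card_bonds_of_arc_tripartition {L : ℕ} [NeZero L] {A B C : Set (ZMod L)}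
    (hA : IsArc A) (hB : IsArc B) (hC : IsArc C)
    (hAne : A.Nonempty) (hBne : B.Nonempty) (hCne : C.Nonempty)
    (hAB : Disjoint A B) (hAC : Disjoint A C) (hBC : Disjoint B C)
    (hUnion : A ∪ B ∪ C = Set.univ) : (bonds A B).card = 1 := by
  have cover (x : ZMod L) : x ∈ A ∨ x ∈ B ∨ x ∈ C := by
    have : x ∈ A ∪ B ∪ C := hUnion ▸ Set.mem_univ x
    simpa [or_assoc] using this
  have two {S T U : Set (ZMod L)} (hS : IsArc S) (hSne : S.Nonempty) (hTne : T.Nonempty)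
      (hST : Disjoint S T) (hSU : Disjoint S U) (hTU : Disjoint T U)
      (hc : ∀ x, x ∈ S ∨ x ∈ T ∨ x ∈ U) : (bonds S T).card + (bonds S U).card = 2 := by
    have hcompl : Sᶜ = T ∪ U := by
      ext x
      have h1 : x ∈ S → x ∉ T := fun hx => Set.disjoint_left.1 hST hx
      have h2 : x ∈ S → x ∉ U := fun hx => Set.disjoint_left.1 hSU hx
      have h3 := hc x
      simp only [Set.mem_compl_iff, Set.mem_union]
      tauto
    rw [← bonds_union_right_card hST hSU hTU, ← hcompl]
    refine hS.card_bonds_compl hSne fun h => ?_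
    obtain ⟨x, hx⟩ := hTne
    exact Set.disjoint_left.1 hST (h ▸ Set.mem_univ x) hx
  have h1 := two hA hAne hBne hAB hAC hBC cover
  have h2 := two hB hBne hAne hAB.symm hBC hAC fun x => by have := cover x; tauto
  have h3 := two hC hCne hAne hAC.symm hBC.symm hAB fun x => by have := cover x; tauto
  rw [bonds_comm B A] at h2
  rw [bonds_comm C A, bonds_comm C B] at h3
  omega

/-- The multiplicative second difference of the CZX sign under flipping two disjoint regions
counts the bonds joining them. -/
lemma czxSign_flipOn_prod {L : ℕ} [NeZero L] {A B : Set (ZMod L)} (hAB : Disjoint A B)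
    (b : ZMod L → Bool) :
    czxSign b * czxSign (flipOn A (flipOn B b)) * (czxSign (flipOn A b) * czxSign (flipOn B b)) =
      (-1) ^ (bonds A B).card := by
  classical
  rw [← Finset.prod_const, bonds, Finset.prod_filter]
  simp only [czxSign, ← Finset.prod_mul_distrib]
  refine Finset.prod_congr rfl fun i _ => ?_
  have h1 : i ∈ A → i ∉ B := fun hi => Set.disjoint_left.1 hAB hi
  have h2 : i + 1 ∈ A → i + 1 ∉ B := fun hi => Set.disjoint_left.1 hAB hi
  simp only [flipOn]
  by_cases hiA : i ∈ A <;> by_cases hiB : i ∈ B <;>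
    by_cases hjA : i + 1 ∈ A <;> by_cases hjB : i + 1 ∈ B <;>
    first
    | exact absurd hiB (h1 hiA)
    | exact absurd hjB (h2 hjA)
    | (simp only [hiA, hiB, hjA, hjB]
       cases b i <;> cases b (i + 1) <;> simp)

/-- No nonzero vector separable with respect to a tripartition of the ring into three
contiguous arcs (with `|A| ≥ 2`) is an eigenvector of the anomalous CZX symmetry. -/
theorem no_tripartite_separable_czx_eigenvector
    (L : ℕ) [NeZero L] (hL4 : 4 ≤ L) (hLe : Even L)
    (A B C : Set (ZMod L)) (hA : IsArc A) (hB : IsArc B) (hC : IsArc C)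
    (hAne : A.Nonempty) (hBne : B.Nonempty) (hCne : C.Nonempty)
    (hAB : Disjoint A B) (hAC : Disjoint A C) (hBC : Disjoint B C)
    (hUnion : A ∪ B ∪ C = Set.univ) (hA2 : 2 ≤ A.ncard)
    (ψ : (ZMod L → Bool) → ℂ) (hψ : ψ ≠ 0) (hsep : SepVec3 A B C ψ)
    (lam : ℂ) (heig : (czxMatrix L).mulVec ψ = lam • ψ) : False := by
  obtain ⟨f, g, h, hfgh⟩ := hsep
  have key (b : ZMod L → Bool) : czxSign b * ψ b = lam * ψ (fun i => ! b i) := by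
    rw [← czxMatrix_mulVec_compl, heig]
    rfl
  obtain ⟨b, hb⟩ := Function.ne_iff.1 hψ
  have hb' : ψ (fun i => ! b i) ≠ 0 := fun h0 =>
    mul_ne_zero (czxSign_ne_zero b) hb (by rw [key b, h0, mul_zero])
  have dAB := Set.disjoint_left.1 hAB
  have dAC := Set.disjoint_left.1 hAC
  have dBC := Set.disjoint_left.1 hBC
  have restrict {S : Set (ZMod L)} {c d : ZMod L → Bool} (hcd : ∀ x ∈ S, c x = d x) :
      (fun x : S => c x.1) = fun x : S => d x.1 := funext fun x => hcd x.1 x.2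
  have hval {c cA cB cC : ZMod L → Bool} (hcA : ∀ x ∈ A, c x = cA x)
      (hcB : ∀ x ∈ B, c x = cB x) (hcC : ∀ x ∈ C, c x = cC x) :
      ψ c = f (fun x => cA x.1) * g (fun x => cB x.1) * h (fun x => cC x.1) := by
    rw [hfgh, restrict hcA, restrict hcB, restrict hcC]
  have e1 := key b
  have e2 := key (flipOn A (flipOn B b))
  have e3 := key (flipOn A b)
  have e4 := key (flipOn B b)
  have hsign := czxSign_flipOn_prod hAB b
  rw [card_bonds_of_arc_tripartition hA hB hC hAne hBne hCne hAB hAC hBC hUnion] at hsign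
  rw [hfgh b] at hb e1
  rw [hfgh fun i => ! b i] at hb' e1
  rw [hval (cA := fun i => ! b i) (cB := fun i => ! b i) (cC := b),
    hval (c := fun i => ! flipOn A (flipOn B b) i) (cA := b) (cB := b) (cC := fun i => ! b i)]
    at e2
  rw [hval (cA := fun i => ! b i) (cB := b) (cC := b),
    hval (c := fun i => ! flipOn A b i) (cA := b) (cB := fun i => ! b i) (cC := fun i => ! b i)]
    at e3
  rw [hval (cA := b) (cB := fun i => ! b i) (cC := b),
    hval (c := fun i => ! flipOn B b i) (cA := fun i => ! b i) (cB := b) (cC := fun i => ! b i)]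
    at e4
  · have q1 := czxSign_mul_self b
    have q2 := czxSign_mul_self (flipOn A (flipOn B b))
    generalize czxSign b = s₁ at *
    generalize czxSign (flipOn A (flipOn B b)) = s₂ at *
    generalize czxSign (flipOn A b) = s₃ at *
    generalize czxSign (flipOn B b) = s₄ at *
    generalize (f fun x => b x.1) = f₀ at *
    generalize (f fun x => ! b x.1) = f₁ at *
    generalize (g fun x => b x.1) = g₀ at *
    generalize (g fun x => ! b x.1) = g₁ at *
    generalize (h fun x => b x.1) = h₀ at *
    generalize (h fun x => ! b x.1) = h₁ at *
    simp only [Pi.zero_apply, ne_eq, mul_eq_zero, not_or] at hb hb'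
    obtain ⟨⟨hf₀, hg₀⟩, hh₀⟩ := hb
    obtain ⟨⟨hf₁, hg₁⟩, -⟩ := hb'
    have hP : f₀ * g₀ * h₀ * (f₁ * g₁ * h₀) ≠ 0 := by simp [*]
    have hprod : s₁ * s₂ = s₃ * s₄ := by
      refine mul_right_cancel₀ hP ?_
      linear_combination (s₂ * (f₁ * g₁ * h₀)) * e1 + (lam * (f₁ * g₁ * h₁)) * e2
        - (s₄ * (f₀ * g₁ * h₀)) * e3 - (lam * (f₀ * g₁ * h₁)) * e4
    have : (1 : ℂ) = -1 := by
      linear_combination hsign + (s₁ * s₂) * hprod - s₂ * s₂ * q1 - q2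
    norm_num at this
  all_goals
    intro x hx
    have h1 := @dAB x
    have h2 := @dAC x
    have h3 := @dBC x
    simp only [flipOn]
    split_ifs <;> simp <;> tauto
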